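/- arXiv:2503.12292 — 3 statements merged into one kernel-verified Lean document; each statement's English description precedes it below -/
import Mathlib

section
/- Let −2 ≤ ν < 0, g ∈ ℝ, and let f : (1,∞) → ℝ be continuous with sup_{r>1} r^{λ̃}|f(r)| < ∞ for some λ̃ > 3. Define 𝗏(r) := −(1/r) ∫_r^∞ s^{ν+1} ( ∫_s^∞ t^{−ν} f(t) dt ) ds and σ := ∫_1^∞ s^{ν+1} ( ∫_s^∞ t^{−ν} f(t) dt ) ds + g. Then v := 𝗏 + σ/r is twice continuously differentiable on (1,∞), satisfies −v''(r) − ((1−ν)/r) v'(r) + ((1+ν)/r²) v(r) = f(r) for all r > 1, v extends continuously to r = 1 with v(1) = g, and r·𝗏(r) → 0 as r → ∞. -/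
open MeasureTheory Filter Set

theorem integrableOn_Ioi_of_abs_le_rpow {p : ℝ → ℝ} {a b C : ℝ} (hb : 0 < b) (ha : a < -1)
    (hp : ContinuousOn p (Ioi b)) (hle : ∀ t ∈ Ioi b, |p t| ≤ C * t ^ a) :
    IntegrableOn p (Ioi b) :=
  ((integrableOn_Ioi_rpow_of_lt ha hb).const_mul C).mono'
    (hp.aestronglyMeasurable measurableSet_Ioi)
    ((ae_restrict_mem measurableSet_Ioi).mono hle)

theorem abs_integral_Ioi_le_of_abs_le_rpow {p : ℝ → ℝ} {a b C : ℝ} (hb : 0 < b) (ha : a < -1)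
    (hle : ∀ t ∈ Ioi b, |p t| ≤ C * t ^ a) :
    |∫ t in Ioi b, p t| ≤ C * (-b ^ (a + 1) / (a + 1)) := by
  rw [← integral_Ioi_rpow_of_lt ha hb, ← integral_const_mul]
  refine norm_integral_le_of_norm_le (f := p)
    ((integrableOn_Ioi_rpow_of_lt ha hb).const_mul C) ?_
  exact (ae_restrict_mem measurableSet_Ioi).mono hle

theorem hasDerivAt_integral_Ioi {p : ℝ → ℝ} {a r : ℝ} (hint : IntegrableOn p (Ioi a))
    (hp : ContinuousOn p (Ioi a)) (hr : a < r) :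
    HasDerivAt (fun x => ∫ t in Ioi x, p t) (-p r) r := by
  have hd : HasDerivAt (fun x => ∫ t in a..x, p t) (p r) r :=
    intervalIntegral.integral_hasDerivAt_right
      ((intervalIntegrable_iff_integrableOn_Ioc_of_le hr.le).2
        (hint.mono_set Ioc_subset_Ioi_self))
      (hp.stronglyMeasurableAtFilter isOpen_Ioi r hr)
      (hp.continuousAt (Ioi_mem_nhds hr))
  refine (hd.const_sub (∫ t in Ioi a, p t)).congr_of_eventuallyEq ?_
  filter_upwards [Ioi_mem_nhds hr] with x hx
  rw [← intervalIntegral.integral_Ioi_sub_Ioi hint (le_of_lt hx)]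
  ring

theorem contDiffOn_two_of_hasDerivAt {v v₁ v₂ : ℝ → ℝ} {s : Set ℝ} (hs : IsOpen s)
    (h₁ : ∀ x ∈ s, HasDerivAt v (v₁ x) x) (h₂ : ∀ x ∈ s, HasDerivAt v₁ (v₂ x) x)
    (hc : ContinuousOn v₂ s) : ContDiffOn ℝ 2 v s := by
  rw [show (2 : WithTop ℕ∞) = 1 + 1 by norm_num, contDiffOn_succ_iff_deriv_of_isOpen hs]
  refine ⟨fun x hx => (h₁ x hx).differentiableAt.differentiableWithinAt, by simp, ?_⟩
  refine ContDiffOn.congr ?_ fun x hx => (h₁ x hx).deriv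
  rw [show (1 : WithTop ℕ∞) = 0 + 1 by norm_num, contDiffOn_succ_iff_deriv_of_isOpen hs]
  refine ⟨fun x hx => (h₂ x hx).differentiableAt.differentiableWithinAt, by simp, ?_⟩
  exact (contDiffOn_zero.2 hc).congr fun x hx => (h₂ x hx).deriv

/-- explicit solution formula for the zero Fourier mode of the swirl
velocity, case `-2 ≤ ν < 0`. -/
theorem stmt4 (ν g : ℝ) (hν1 : -2 ≤ ν) (hν2 : ν < 0) (f : ℝ → ℝ)
    (hf_cont : ContinuousOn f (Set.Ioi 1))
    (lt : ℝ) (hlt : 3 < lt) (M : ℝ)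
    (hfM : ∀ r : ℝ, 1 < r → r ^ lt * |f r| ≤ M)
    (vv : ℝ → ℝ)
    (hvv : ∀ r : ℝ, vv r =
      -(1 / r) * ∫ s in Set.Ioi r, s ^ (ν + 1) * ∫ t in Set.Ioi s, t ^ (-ν) * f t)
    (σ : ℝ)
    (hσ : σ = (∫ s in Set.Ioi (1:ℝ), s ^ (ν + 1) * ∫ t in Set.Ioi s, t ^ (-ν) * f t) + g) :
    ContDiffOn ℝ 2 (fun r : ℝ => vv r + σ / r) (Set.Ioi 1)
    ∧ (∀ r : ℝ, 1 < r →
        -(deriv (deriv (fun r' : ℝ => vv r' + σ / r')) r)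
          - ((1 - ν) / r) * deriv (fun r' : ℝ => vv r' + σ / r') r
          + ((1 + ν) / r ^ 2) * (vv r + σ / r) = f r)
    ∧ Filter.Tendsto (fun r : ℝ => vv r + σ / r) (nhdsWithin 1 (Set.Ioi 1)) (nhds g)
    ∧ Filter.Tendsto (fun r : ℝ => r * vv r) Filter.atTop (nhds 0) := by
  have hpos : ∀ r ∈ Ioi (1 : ℝ), 0 < r := fun r hr => one_pos.trans hr
  have hpow : ∀ a : ℝ, ContinuousOn (fun r : ℝ => r ^ a) (Ioi 1) := fun a r hr =>
    (Real.continuousAt_rpow_const r a (Or.inl (hpos r hr).ne')).continuousWithinAt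
  have hp_cont : ContinuousOn (fun t : ℝ => t ^ (-ν) * f t) (Ioi 1) := (hpow _).mul hf_cont
  have hp_le : ∀ t ∈ Ioi (1 : ℝ), |t ^ (-ν) * f t| ≤ M * t ^ (-ν - lt) := by
    intro t ht
    have h0 := hpos t ht
    have hf : |f t| ≤ M / t ^ lt := by
      rw [le_div_iff₀ (Real.rpow_pos_of_pos h0 _), mul_comm]
      exact hfM t ht
    rw [abs_mul, abs_of_pos (Real.rpow_pos_of_pos h0 _), Real.rpow_sub h0]
    calc t ^ (-ν) * |f t| ≤ t ^ (-ν) * (M / t ^ lt) := by gcongr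
      _ = M * (t ^ (-ν) / t ^ lt) := by ring
  have hexp : -ν - lt < -1 := by linarith
  have hp_int := integrableOn_Ioi_of_abs_le_rpow one_pos hexp hp_cont hp_le
  set F : ℝ → ℝ := fun s => ∫ t in Ioi s, t ^ (-ν) * f t
  have hF_deriv : ∀ r ∈ Ioi (1 : ℝ), HasDerivAt F (-(r ^ (-ν) * f r)) r := fun r hr =>
    hasDerivAt_integral_Ioi hp_int hp_cont hr
  have hF_cont : ContinuousOn F (Ioi 1) := fun r hr =>
    (hF_deriv r hr).continuousAt.continuousWithinAt
  have hh_cont : ContinuousOn (fun s : ℝ => s ^ (ν + 1) * F s) (Ioi 1) := (hpow _).mul hF_cont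
  have hh_le : ∀ s ∈ Ioi (1 : ℝ),
      |s ^ (ν + 1) * F s| ≤ (-M / (-ν - lt + 1)) * s ^ (2 - lt) := by
    intro s hs
    have h0 := hpos s hs
    have hFs : |F s| ≤ M * (-s ^ (-ν - lt + 1) / (-ν - lt + 1)) :=
      abs_integral_Ioi_le_of_abs_le_rpow h0 hexp fun t ht => hp_le t (Ioi_subset_Ioi (le_of_lt hs) ht)
    rw [abs_mul, abs_of_pos (Real.rpow_pos_of_pos h0 _)]
    calc s ^ (ν + 1) * |F s|
        ≤ s ^ (ν + 1) * (M * (-s ^ (-ν - lt + 1) / (-ν - lt + 1))) := by gcongr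
      _ = (-M / (-ν - lt + 1)) * (s ^ (ν + 1) * s ^ (-ν - lt + 1)) := by ring
      _ = (-M / (-ν - lt + 1)) * s ^ (2 - lt) := by
        rw [← Real.rpow_add h0]; ring_nf
  have hh_int := integrableOn_Ioi_of_abs_le_rpow one_pos (by linarith) hh_cont hh_le
  set H : ℝ → ℝ := fun r => ∫ s in Ioi r, s ^ (ν + 1) * F s
  have hH_deriv : ∀ r ∈ Ioi (1 : ℝ), HasDerivAt H (-(r ^ (ν + 1) * F r)) r := fun r hr =>
    hasDerivAt_integral_Ioi hh_int hh_cont hr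
  have hH_cont : ContinuousOn H (Ioi 1) := fun r hr =>
    (hH_deriv r hr).continuousAt.continuousWithinAt
  have hvH : ∀ r, vv r = -(1 / r) * H r := hvv
  have hσH : σ = H 1 + g := hσ
  have hv : (fun r => vv r + σ / r) = fun r => (σ - H r) / r := by
    funext r
    rw [hvH r]
    ring
  have hv₁ : ∀ r ∈ Ioi (1 : ℝ), HasDerivAt (fun r => vv r + σ / r)
      (r ^ ν * F r - (σ - H r) / r ^ 2) r := by
    intro r hr
    have h0 := hpos r hr
    rw [hv]
    refine (((hH_deriv r hr).const_sub σ).div (hasDerivAt_id r) h0.ne').congr_deriv ?_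
    rw [Real.rpow_add_one h0.ne']
    simp only [id]
    field_simp
  have hv₂ : ∀ r ∈ Ioi (1 : ℝ), HasDerivAt (fun r => r ^ ν * F r - (σ - H r) / r ^ 2)
      ((ν - 1) * r ^ (ν - 1) * F r - f r + 2 * (σ - H r) / r ^ 3) r := by
    intro r hr
    have h0 := hpos r hr
    refine (((Real.hasDerivAt_rpow_const (p := ν) (Or.inl h0.ne')).mul (hF_deriv r hr)).sub
      (((hH_deriv r hr).const_sub σ).div (hasDerivAt_pow 2 r) (by positivity))).congr_deriv ?_
    have hn : r ^ ν ≠ 0 := (Real.rpow_pos_of_pos h0 ν).ne'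
    rw [Real.rpow_add_one h0.ne', Real.rpow_sub_one h0.ne', Real.rpow_neg h0.le]
    push_cast
    field_simp
    ring
  have hv₂_cont : ContinuousOn
      (fun r => (ν - 1) * r ^ (ν - 1) * F r - f r + 2 * (σ - H r) / r ^ 3) (Ioi 1) :=
    (((continuousOn_const.mul (hpow _)).mul hF_cont).sub hf_cont).add
      ((continuousOn_const.mul (continuousOn_const.sub hH_cont)).div (continuousOn_id.pow 3)
        fun r hr => (pow_pos (hpos r hr) 3).ne')
  refine ⟨contDiffOn_two_of_hasDerivAt isOpen_Ioi hv₁ hv₂ hv₂_cont, ?_, ?_, ?_⟩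
  · intro r hr
    have h0 := hpos r hr
    have hd : deriv (fun r => vv r + σ / r) =ᶠ[nhds r]
        fun r => r ^ ν * F r - (σ - H r) / r ^ 2 :=
      eventually_of_mem (Ioi_mem_nhds hr) fun x hx => (hv₁ x hx).deriv
    rw [hd.deriv_eq, (hv₂ r hr).deriv, (hv₁ r hr).deriv, show vv r + σ / r = (σ - H r) / r from
      congrFun hv r, Real.rpow_sub_one h0.ne']
    field_simp
    ring
  · rw [hv]
    have hH1 : Tendsto H (nhdsWithin 1 (Ioi 1)) (nhds (H 1)) :=
      (hh_int.continuousWithinAt_Ici_primitive_Ioi).mono Ioi_subset_Ici_self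
    have hid : Tendsto (fun r : ℝ => r) (nhdsWithin 1 (Ioi 1)) (nhds 1) :=
      tendsto_id.mono_left nhdsWithin_le_nhds
    convert! (hH1.const_sub σ).div hid one_ne_zero using 2
    rw [hσH]
    ring
  · have hH0 : Tendsto (fun r => -H r) atTop (nhds 0) := by
      have : Tendsto H atTop (nhds 0) := tendsto_integral_Ioi_zero tendsto_id
      simpa only [neg_zero] using this.neg
    refine hH0.congr' ?_
    filter_upwards [eventually_gt_atTop 0] with r hr
    rw [hvH r]
    field_simp
end

section
/- Let −2 ≤ ν < 0 and λ̃ > 3. There exists a constant C = C(ν,λ̃) > 0 such that for every g ∈ ℝ and every continuous f : (1,∞) → ℝ with ‖f‖_{L^∞_{λ̃}} < ∞, the functions 𝗏(r) := −(1/r) ∫_r^∞ s^{ν+1} ( ∫_s^∞ t^{−ν} f(t) dt ) ds and σ := ∫_1^∞ s^{ν+1} ( ∫_s^∞ t^{−ν} f(t) dt ) ds + g satisfy ‖𝗏''‖_{L^∞_{λ̃}} + ‖𝗏'‖_{L^∞_{λ̃−1}} + ‖𝗏‖_{L^∞_{λ̃−2}} + |σ| ≤ C ( ‖f‖_{L^∞_{λ̃}}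 + |g| ). -/
open MeasureTheory Filter Set

/-- Weighted `L^∞` norm: `‖s‖_{L^∞_ζ} = sup_{r>1} r^ζ |s(r)|`. -/
noncomputable def wnorm (ζ : ℝ) (f : ℝ → ℝ) : ℝ :=
  ⨆ r : Set.Ioi (1:ℝ), (r : ℝ) ^ ζ * |f (r : ℝ)|

theorem wnorm_le_of_forall_abs_le {ζ K : ℝ} {h : ℝ → ℝ}
    (hh : ∀ r, 1 < r → |h r| ≤ K * r ^ (-ζ)) : wnorm ζ h ≤ K := by
  have : Nonempty (Set.Ioi (1:ℝ)) := ⟨⟨2, by norm_num⟩⟩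
  refine ciSup_le fun ⟨r, hr⟩ => ?_
  have hr0 : (0:ℝ) < r := one_pos.trans hr
  calc r ^ ζ * |h r| ≤ r ^ ζ * (K * r ^ (-ζ)) := by gcongr; exact hh r hr
    _ = K * r ^ (ζ + -ζ) := by rw [Real.rpow_add hr0]; ring
    _ = K := by simp

theorem wnorm_nonneg (ζ : ℝ) (h : ℝ → ℝ) : 0 ≤ wnorm ζ h :=
  Real.iSup_nonneg fun ⟨_, hr⟩ =>
    mul_nonneg (Real.rpow_nonneg (one_pos.trans hr).le _) (abs_nonneg _)

theorem abs_le_wnorm_mul_rpow_neg {ζ : ℝ} {h : ℝ → ℝ}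
    (hb : BddAbove (Set.range fun r : Set.Ioi (1:ℝ) => (r : ℝ) ^ ζ * |h (r : ℝ)|))
    {r : ℝ} (hr : 1 < r) : |h r| ≤ wnorm ζ h * r ^ (-ζ) := by
  have hr0 : (0:ℝ) < r := one_pos.trans hr
  have hle : r ^ ζ * |h r| ≤ wnorm ζ h := le_ciSup hb ⟨r, hr⟩
  rw [Real.rpow_neg hr0.le, ← div_eq_mul_inv, le_div_iff₀ (Real.rpow_pos_of_pos hr0 ζ)]
  linarith

section TailIntegral

variable {h : ℝ → ℝ} {M a : ℝ}

theorem integrableOn_Ioi_of_abs_le_rpow_s5 (ha : 1 < a) (hc : ContinuousOn h (Ioi 1))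
    (hM : ∀ t, 1 < t → |h t| ≤ M * t ^ (-a)) {r : ℝ} (hr : 1 ≤ r) : IntegrableOn h (Ioi r) := by
  refine Integrable.mono' ((integrableOn_Ioi_rpow_of_lt (a := -a) (by linarith)
    (one_pos.trans_le hr)).const_mul M)
    ((hc.mono (Ioi_subset_Ioi hr)).aestronglyMeasurable measurableSet_Ioi) ?_
  exact (ae_restrict_mem measurableSet_Ioi).mono fun t ht => hM t (hr.trans_lt ht)

theorem abs_integral_Ioi_le_of_abs_le_rpow_s5 (ha : 1 < a)
    (hM : ∀ t, 1 < t → |h t| ≤ M * t ^ (-a)) {r : ℝ} (hr : 1 ≤ r) :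
    |∫ t in Ioi r, h t| ≤ M / (a - 1) * r ^ (1 - a) := by
  have hr0 : 0 < r := one_pos.trans_le hr
  have hle := norm_integral_le_of_norm_le (f := h)
    ((integrableOn_Ioi_rpow_of_lt (a := -a) (by linarith) hr0).const_mul M)
    ((ae_restrict_mem measurableSet_Ioi).mono fun t ht => hM t (hr.trans_lt ht))
  rw [integral_const_mul, integral_Ioi_rpow_of_lt (by linarith) hr0, Real.norm_eq_abs] at hle
  refine hle.trans_eq ?_
  have h1 : a - 1 ≠ 0 := by linarith
  have h2 : -a + 1 ≠ 0 := by linarith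
  rw [show (1 - a) = -a + 1 by ring]
  field_simp
  ring

theorem hasDerivAt_integral_Ioi_of_abs_le_rpow (ha : 1 < a) (hc : ContinuousOn h (Ioi 1))
    (hM : ∀ t, 1 < t → |h t| ≤ M * t ^ (-a)) {r : ℝ} (hr : 1 < r) :
    HasDerivAt (fun x => ∫ t in Ioi x, h t) (-h r) r := by
  have hi := integrableOn_Ioi_of_abs_le_rpow_s5 ha hc hM le_rfl
  have hd := intervalIntegral.integral_hasDerivAt_right (a := 1) (b := r)
    ((intervalIntegrable_iff_integrableOn_Ioc_of_le hr.le).2 (hi.mono_set Ioc_subset_Ioi_self))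
    (hc.stronglyMeasurableAtFilter isOpen_Ioi r hr) (hc.continuousAt (Ioi_mem_nhds hr))
  refine (hd.const_sub (∫ t in Ioi 1, h t)).congr_of_eventuallyEq ?_
  filter_upwards [Ioi_mem_nhds hr] with x hx
  rw [← intervalIntegral.integral_Ioi_sub_Ioi hi (le_of_lt hx)]
  ring

end TailIntegral

/-- weighted estimate for the zero mode of the swirl velocity,
case `-2 ≤ ν < 0`. -/
theorem stmt5 (ν lt : ℝ) (hν1 : -2 ≤ ν) (hν2 : ν < 0) (hlt : 3 < lt) :
    ∃ C > 0, ∀ (g : ℝ) (f : ℝ → ℝ), ContinuousOn f (Set.Ioi 1) →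
      BddAbove (Set.range fun r : Set.Ioi (1:ℝ) => (r : ℝ) ^ lt * |f (r : ℝ)|) →
      ∀ (vv : ℝ → ℝ) (σ : ℝ),
        (∀ r : ℝ, vv r =
          -(1 / r) * ∫ s in Set.Ioi r, s ^ (ν + 1) * ∫ t in Set.Ioi s, t ^ (-ν) * f t) →
        σ = (∫ s in Set.Ioi (1:ℝ), s ^ (ν + 1) * ∫ t in Set.Ioi s, t ^ (-ν) * f t) + g →
        wnorm lt (deriv (deriv vv)) + wnorm (lt - 1) (deriv vv) + wnorm (lt - 2) vv + |σ|
          ≤ C * (wnorm lt f + |g|) := by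
  obtain ⟨A, hA, hA0⟩ : ∃ A, A = 1 / (lt + ν - 1) ∧ 0 < A :=
    ⟨_, rfl, by apply one_div_pos.2; linarith⟩
  obtain ⟨B, hB, hB0⟩ : ∃ B, B = 1 / (lt - 3) ∧ 0 < B :=
    ⟨_, rfl, by apply one_div_pos.2; linarith⟩
  refine ⟨(2 * (A * B) + A + |ν| * A + 1) + (A * B + A) + A * B + A * B + 1, by positivity, ?_⟩
  intro g f hf hbdd vv σ hvv hσ
  set N := wnorm lt f
  have hN : 0 ≤ N := wnorm_nonneg lt f
  have hrpow (p : ℝ) : ContinuousOn (fun t : ℝ => t ^ p) (Ioi 1) := fun t ht =>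
    (Real.continuousAt_rpow_const t p
      (Or.inl (one_pos.trans ht).ne')).continuousWithinAt
  have rpow_mul_le {r : ℝ} (hr : 1 < r) {p q s x K : ℝ} (hx : |x| ≤ K * r ^ q)
      (hs : p + q = s) : |r ^ p * x| ≤ K * r ^ s := by
    have hr0 : 0 < r := one_pos.trans hr
    rw [abs_mul, abs_of_nonneg (Real.rpow_nonneg hr0.le p), ← hs, Real.rpow_add hr0]
    calc r ^ p * |x| ≤ r ^ p * (K * r ^ q) := by gcongr
      _ = _ := by ring
  set F : ℝ → ℝ := fun s => ∫ t in Ioi s, t ^ (-ν) * f t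
  set G : ℝ → ℝ := fun r => ∫ s in Ioi r, s ^ (ν + 1) * F s
  have hfle {r : ℝ} (hr : 1 < r) : |f r| ≤ N * r ^ (-lt) := abs_le_wnorm_mul_rpow_neg hbdd hr
  have hFint (t : ℝ) (ht : 1 < t) : |t ^ (-ν) * f t| ≤ N * t ^ (-(lt + ν)) :=
    rpow_mul_le ht (hfle ht) (by ring)
  have hFle {r : ℝ} (hr : 1 < r) : |F r| ≤ N * A * r ^ (1 - (lt + ν)) := by
    have := abs_integral_Ioi_le_of_abs_le_rpow_s5 (by linarith) hFint hr.le
    rwa [div_eq_mul_one_div, ← hA] at this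
  have hFderiv {r : ℝ} (hr : 1 < r) : HasDerivAt F (-(r ^ (-ν) * f r)) r :=
    hasDerivAt_integral_Ioi_of_abs_le_rpow (by linarith) ((hrpow _).mul hf) hFint hr
  have hFcont : ContinuousOn F (Ioi 1) := fun r hr => (hFderiv hr).continuousAt.continuousWithinAt
  have hGint (t : ℝ) (ht : 1 < t) : |t ^ (ν + 1) * F t| ≤ N * A * t ^ (-(lt - 2)) :=
    rpow_mul_le ht (hFle ht) (by ring)
  have hGle {r : ℝ} (hr : 1 ≤ r) : |G r| ≤ N * A * B * r ^ (1 - (lt - 2)) := by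
    have := abs_integral_Ioi_le_of_abs_le_rpow_s5 (by linarith) hGint hr
    rwa [div_eq_mul_one_div, show lt - 2 - 1 = lt - 3 by ring, ← hB] at this
  have hGderiv {r : ℝ} (hr : 1 < r) : HasDerivAt G (-(r ^ (ν + 1) * F r)) r :=
    hasDerivAt_integral_Ioi_of_abs_le_rpow (by linarith) ((hrpow _).mul hFcont) hGint hr
  have hpow {r : ℝ} (hr : 1 < r) (p : ℝ) : HasDerivAt (fun x : ℝ => x ^ p) (p * r ^ (p - 1)) r :=
    Real.hasDerivAt_rpow_const (Or.inl (one_pos.trans hr).ne')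
  have hv {r : ℝ} : vv r = -(r ^ (-1 : ℝ) * G r) := by
    rw [hvv r, Real.rpow_neg_one]; ring
  have hv' {r : ℝ} (hr : 1 < r) : deriv vv r = r ^ (-2 : ℝ) * G r + r ^ ν * F r := by
    have hd := ((hpow hr (-1)).mul (hGderiv hr)).neg
    rw [show vv = fun r => -(r ^ (-1 : ℝ) * G r) from funext fun _ => hv]
    refine hd.deriv.trans ?_
    have h1 : r ^ ν = r ^ (-1 : ℝ) * r ^ (ν + 1) := by
      rw [← Real.rpow_add (one_pos.trans hr)]; ring_nf
    rw [show (-1 : ℝ) - 1 = -2 by norm_num]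
    linear_combination -(F r) * h1
  have hv'' {r : ℝ} (hr : 1 < r) : deriv (deriv vv) r =
      -2 * (r ^ (-3 : ℝ) * G r) - r ^ (ν - 1) * F r + ν * (r ^ (ν - 1) * F r) - f r := by
    have heq : deriv vv =ᶠ[nhds r] fun r => r ^ (-2 : ℝ) * G r + r ^ ν * F r := by
      filter_upwards [Ioi_mem_nhds hr] with x hx using hv' hx
    have hd := ((hpow hr (-2)).mul (hGderiv hr)).add ((hpow hr ν).mul (hFderiv hr))
    rw [heq.deriv_eq]
    refine hd.deriv.trans ?_
    have hr0 : 0 < r := one_pos.trans hr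
    have h1 : r ^ (ν - 1) = r ^ (-2 : ℝ) * r ^ (ν + 1) := by
      rw [← Real.rpow_add hr0]; ring_nf
    have h2 : r ^ ν * r ^ (-ν) = 1 := by rw [← Real.rpow_add hr0]; simp
    rw [show (-2 : ℝ) - 1 = -3 by norm_num]
    linear_combination (F r) * h1 - (f r) * h2
  have hw0 : wnorm (lt - 2) vv ≤ N * A * B := wnorm_le_of_forall_abs_le fun r hr => by
    rw [hv, abs_neg]
    exact rpow_mul_le hr (hGle hr.le) (by ring)
  have hw1 : wnorm (lt - 1) (deriv vv) ≤ N * A * B + N * A :=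
    wnorm_le_of_forall_abs_le fun r hr => by
      rw [hv' hr, add_mul]
      exact (abs_add_le _ _).trans (add_le_add (rpow_mul_le hr (hGle hr.le) (by ring))
        (rpow_mul_le hr (hFle hr) (by ring)))
  have hw2 : wnorm lt (deriv (deriv vv)) ≤ 2 * (N * A * B) + N * A + |ν| * (N * A) + N :=
    wnorm_le_of_forall_abs_le fun r hr => by
      have h1 : |r ^ (-3 : ℝ) * G r| ≤ N * A * B * r ^ (-lt) :=
        rpow_mul_le hr (hGle hr.le) (by ring)
      have h2 : |r ^ (ν - 1) * F r| ≤ N * A * r ^ (-lt) := rpow_mul_le hr (hFle hr) (by ring)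
      rw [hv'' hr]
      calc _ ≤ |-2 * (r ^ (-3 : ℝ) * G r)| + |r ^ (ν - 1) * F r|
            + |ν * (r ^ (ν - 1) * F r)| + |f r| :=
            (abs_sub _ _).trans (add_le_add_left ((abs_add_le _ _).trans
              (add_le_add_left (abs_sub _ _) _)) _)
        _ ≤ 2 * (N * A * B * r ^ (-lt)) + N * A * r ^ (-lt) + |ν| * (N * A * r ^ (-lt))
            + N * r ^ (-lt) := by
          rw [abs_mul (-2), abs_mul ν, show |(-2 : ℝ)| = 2 by norm_num]
          gcongr
          exact hfle hr
        _ = _ := by ring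
  have hw3 : |σ| ≤ N * A * B + |g| := by
    have hG1 := hGle (le_refl 1)
    rw [Real.one_rpow, mul_one] at hG1
    rw [hσ]
    exact (abs_add_le _ _).trans (add_le_add_left hG1 _)
  have hg : 0 ≤ ((2 * (A * B) + A + |ν| * A + 1) + (A * B + A) + A * B + A * B) * |g| := by
    positivity
  linarith
end

section
/- Let ν < 0 be such that α := |1 + ν/2| is not an integer. Then there exists a constant C_ν > 0 such that for every nonzero integer k, every real r ≥ 1, and every n ∈ {0,1,2}, the function ℐ_k(r) := r^{ν/2} I_α(|k| r) satisfies | (d^n/dr^n) ℐ_k(r) | ≤ C_ν |k|^{n − 1/2} r^{(ν−1)/2} e^{|k| r}. -/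
open MeasureTheory Filter Set

/-- Modified Bessel function of the first kind `I_α`. -/
noncomputable def besselI (α x : ℝ) : ℝ :=
  ∑' m : ℕ, (1 / ((m.factorial : ℝ) * Real.Gamma ((m : ℝ) + α + 1)))
    * (x / 2) ^ (2 * (m : ℝ) + α)

/-- Modified Bessel function of the second kind `K_α` (non-integer `α`). -/
noncomputable def besselK (α x : ℝ) : ℝ :=
  (Real.pi / 2) * (besselI (-α) x - besselI α x) / Real.sin (α * Real.pi)

/-- The entire function `F_β(y) = ∑ y ^ m / (m! Γ(m + β + 1))`, for which
`I_β(x) = (x / 2) ^ β F_β(x² / 4)`. -/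
noncomputable def besselAux (β y : ℝ) : ℝ :=
  ∑' m : ℕ, (1 / ((m.factorial : ℝ) * Real.Gamma ((m : ℝ) + β + 1))) * y ^ m

lemma Gamma_le_Gamma_natCast_add {β : ℝ} (hβ : 0 ≤ β) (m : ℕ) :
    Real.Gamma (β + 1) ≤ Real.Gamma ((m : ℝ) + β + 1) := by
  induction m with
  | zero => simp
  | succ m ih =>
    have hpos : 0 < Real.Gamma ((m : ℝ) + β + 1) := Real.Gamma_pos_of_pos (by positivity)
    have hm : (0 : ℝ) ≤ m := m.cast_nonneg
    rw [show ((m + 1 : ℕ) : ℝ) + β + 1 = ((m : ℝ) + β + 1) + 1 by push_cast; ring,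
      Real.Gamma_add_one (s := (m : ℝ) + β + 1) (by positivity)]
    nlinarith

lemma summable_besselAux {β : ℝ} (hβ : 0 ≤ β) (y : ℝ) :
    Summable fun m : ℕ => (1 / ((m.factorial : ℝ) * Real.Gamma ((m : ℝ) + β + 1))) * y ^ m := by
  have hG : 0 < Real.Gamma (β + 1) := Real.Gamma_pos_of_pos (by positivity)
  refine Summable.of_norm_bounded
    ((Real.summable_pow_div_factorial |y|).mul_left (1 / Real.Gamma (β + 1))) fun m => ?_
  have hm : 0 < Real.Gamma ((m : ℝ) + β + 1) := Real.Gamma_pos_of_pos (by positivity)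
  rw [norm_mul, norm_pow, Real.norm_eq_abs, Real.norm_eq_abs, abs_of_pos (by positivity)]
  calc 1 / ((m.factorial : ℝ) * Real.Gamma ((m : ℝ) + β + 1)) * |y| ^ m
      ≤ 1 / ((m.factorial : ℝ) * Real.Gamma (β + 1)) * |y| ^ m := by
        gcongr
        exact Gamma_le_Gamma_natCast_add hβ m
    _ = 1 / Real.Gamma (β + 1) * (|y| ^ m / m.factorial) := by field_simp

lemma besselAux_deriv_coeff (β : ℝ) (m : ℕ) (y : ℝ) :
    (1 / (((m + 1).factorial : ℝ) * Real.Gamma (((m + 1 : ℕ) : ℝ) + β + 1))) *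
        (((m + 1 : ℕ) : ℝ) * y ^ (m + 1 - 1)) =
      (1 / ((m.factorial : ℝ) * Real.Gamma ((m : ℝ) + (β + 1) + 1))) * y ^ m := by
  rw [Nat.factorial_succ, show ((m + 1 : ℕ) : ℝ) + β + 1 = (m : ℝ) + (β + 1) + 1 by
    push_cast; ring, Nat.add_sub_cancel]
  have h1 : ((m + 1 : ℕ) : ℝ) ≠ 0 := by positivity
  have h2 : (m.factorial : ℝ) ≠ 0 := by positivity
  push_cast at h1 ⊢
  simp only [one_div, mul_inv]
  field_simp

lemma hasDerivAt_besselAux {β : ℝ} (hβ : 0 ≤ β) (y : ℝ) :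
    HasDerivAt (besselAux β) (besselAux (β + 1) y) y := by
  have hsum : ∀ z : ℝ, Summable fun m : ℕ =>
      (1 / ((m.factorial : ℝ) * Real.Gamma ((m : ℝ) + β + 1))) * ((m : ℝ) * z ^ (m - 1)) := by
    intro z
    rw [← summable_nat_add_iff 1]
    simp_rw [besselAux_deriv_coeff]
    exact summable_besselAux (by positivity) z
  have hval : besselAux (β + 1) y = ∑' m : ℕ,
      (1 / ((m.factorial : ℝ) * Real.Gamma ((m : ℝ) + β + 1))) * ((m : ℝ) * y ^ (m - 1)) := by
    rw [(hsum y).tsum_eq_zero_add]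
    simp_rw [besselAux_deriv_coeff]
    simp [besselAux]
  rw [hval]
  have hterm : ∀ (m : ℕ) (z : ℝ), z ∈ Metric.ball (0 : ℝ) (|y| + 1) →
      HasDerivAt (fun z : ℝ => (1 / ((m.factorial : ℝ) * Real.Gamma ((m : ℝ) + β + 1))) * z ^ m)
        ((1 / ((m.factorial : ℝ) * Real.Gamma ((m : ℝ) + β + 1))) * ((m : ℝ) * z ^ (m - 1))) z :=
    fun m z _ => (hasDerivAt_pow m z).const_mul _
  refine hasDerivAt_tsum_of_isPreconnected (hsum (|y| + 1)) Metric.isOpen_ball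
    (convex_ball _ _).isPreconnected hterm (fun m z hz => ?_)
    (Metric.mem_ball_self (by positivity)) (summable_besselAux hβ 0) (by simp)
  have hm : 0 < Real.Gamma ((m : ℝ) + β + 1) := Real.Gamma_pos_of_pos (by positivity)
  have hz' : |z| ≤ |y| + 1 := by simpa using (mem_ball_zero_iff.mp hz).le
  rw [norm_mul, norm_mul, norm_pow, Real.norm_eq_abs, Real.norm_eq_abs, Real.norm_eq_abs,
    abs_of_pos (by positivity), Nat.abs_cast]
  gcongr

lemma besselAux_recurrence {β : ℝ} (hβ : 0 ≤ β) (y : ℝ) :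
    besselAux β y = (β + 1) * besselAux (β + 1) y + y * besselAux (β + 2) y := by
  have h0 := summable_besselAux hβ y
  have h1 := summable_besselAux (β := β + 1) (by positivity) y
  have hcoeff : ∀ m : ℕ,
      (1 / ((m.factorial : ℝ) * Real.Gamma ((m : ℝ) + β + 1))) * y ^ m -
        (β + 1) * ((1 / ((m.factorial : ℝ) * Real.Gamma ((m : ℝ) + (β + 1) + 1))) * y ^ m) =
      (m : ℝ) * (1 / ((m.factorial : ℝ) * Real.Gamma ((m : ℝ) + (β + 1) + 1))) * y ^ m := by
    intro m
    have hm : 0 < Real.Gamma ((m : ℝ) + β + 1) := Real.Gamma_pos_of_pos (by positivity)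
    have hm' : (0 : ℝ) < (m : ℝ) + β + 1 := by positivity
    rw [show (m : ℝ) + (β + 1) + 1 = ((m : ℝ) + β + 1) + 1 by ring,
      Real.Gamma_add_one hm'.ne']
    have h2 : (m.factorial : ℝ) ≠ 0 := by positivity
    field_simp
    ring
  have hs := h0.sub (h1.mul_left (β + 1))
  have key : besselAux β y - (β + 1) * besselAux (β + 1) y = y * besselAux (β + 2) y := by
    unfold besselAux
    rw [← tsum_mul_left, ← h0.tsum_sub (h1.mul_left (β + 1)), hs.tsum_eq_zero_add,
      ← tsum_mul_left]
    simp_rw [hcoeff]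
    simp only [Nat.cast_zero, zero_mul, zero_add]
    refine tsum_congr fun m => ?_
    have := besselAux_deriv_coeff (β + 1) m y
    rw [Nat.add_sub_cancel, show (m : ℝ) + (β + 1 + 1) + 1 = (m : ℝ) + (β + 2) + 1 by ring] at this
    linear_combination y * this
  linarith

lemma besselAux_nonneg {β y : ℝ} (hβ : 0 ≤ β) (hy : 0 ≤ y) : 0 ≤ besselAux β y := by
  refine tsum_nonneg fun m => ?_
  have hm : 0 < Real.Gamma ((m : ℝ) + β + 1) := Real.Gamma_pos_of_pos (by positivity)
  positivity

lemma besselI_eq_rpow_mul_besselAux (β : ℝ) {x : ℝ} (hx : 0 < x) :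
    besselI β x = (x / 2) ^ β * besselAux β ((x / 2) ^ 2) := by
  unfold besselI besselAux
  rw [← tsum_mul_left]
  refine tsum_congr fun m => ?_
  have h2 : 0 < x / 2 := by positivity
  rw [Real.rpow_add h2, show (2 * (m : ℝ)) = ((2 * m : ℕ) : ℝ) by push_cast; ring,
    Real.rpow_natCast, pow_mul]
  ring

lemma besselI_nonneg {β x : ℝ} (hβ : 0 ≤ β) (hx : 0 < x) : 0 ≤ besselI β x := by
  rw [besselI_eq_rpow_mul_besselAux β hx]
  have := besselAux_nonneg hβ (sq_nonneg (x / 2))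
  positivity

lemma hasDerivAt_besselI {β x : ℝ} (hβ : 0 ≤ β) (hx : 0 < x) :
    HasDerivAt (besselI β) (besselI (β + 1) x + β / x * besselI β x) x := by
  have h2 : 0 < x / 2 := by positivity
  have hhalf : HasDerivAt (fun x : ℝ => x / 2) (1 / 2) x := (hasDerivAt_id x).div_const 2
  have hsq : HasDerivAt (fun x : ℝ => (x / 2) ^ 2) (x / 2) x := by
    refine (hhalf.pow 2).congr_deriv ?_
    norm_num
    ring
  have hd := (hhalf.rpow_const (p := β) (Or.inl h2.ne')).mul
    ((hasDerivAt_besselAux hβ ((x / 2) ^ 2)).comp x hsq)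
  have hev : besselI β =ᶠ[nhds x]
      fun x => (x / 2) ^ β * besselAux β ((x / 2) ^ 2) := by
    filter_upwards [lt_mem_nhds hx] with t ht using besselI_eq_rpow_mul_besselAux β ht
  refine (hd.congr_of_eventuallyEq hev).congr_deriv ?_
  rw [besselI_eq_rpow_mul_besselAux β hx, besselI_eq_rpow_mul_besselAux (β + 1) hx,
    Real.rpow_sub_one h2.ne', Real.rpow_add_one h2.ne']
  simp only [Function.comp_apply]
  field_simp
  ring

lemma besselI_recurrence {β x : ℝ} (hβ : 0 ≤ β) (hx : 0 < x) :
    besselI β x = 2 * (β + 1) / x * besselI (β + 1) x + besselI (β + 2) x := by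
  have h2 : 0 < x / 2 := by positivity
  rw [besselI_eq_rpow_mul_besselAux β hx, besselI_eq_rpow_mul_besselAux (β + 1) hx,
    besselI_eq_rpow_mul_besselAux (β + 2) hx, besselAux_recurrence hβ,
    Real.rpow_add_one h2.ne', Real.rpow_add h2, Real.rpow_two]
  field_simp

lemma hasDerivAt_besselI_add_one {β x : ℝ} (hβ : 0 ≤ β) (hx : 0 < x) :
    HasDerivAt (besselI (β + 1)) (besselI β x - (β + 1) / x * besselI (β + 1) x) x := by
  refine (hasDerivAt_besselI (β := β + 1) (by positivity) hx).congr_deriv ?_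
  rw [besselI_recurrence hβ hx, show β + 1 + 1 = β + 2 by ring]
  ring

/-- With `u = √x I_β`, the quantity `u + u'` grows at most like `e ^ x`, because
`u'' = (1 + (β² - 1/4) / x²) u`. -/
lemma exists_besselI_le {β : ℝ} (hβ : 0 ≤ β) :
    ∃ C > 0, ∀ x : ℝ, 1 ≤ x → besselI β x ≤ C * x ^ (-(1 / 2) : ℝ) * Real.exp x := by
  set E : ℝ → ℝ := fun x =>
    √x * (besselI β x + besselI (β + 1) x + (β + 1 / 2) / x * besselI β x) with hE
  set w : ℝ → ℝ := fun x => Real.exp (β ^ 2 / x - x) * E x with hw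
  have hEd : ∀ x : ℝ, 0 < x →
      HasDerivAt E (E x + (β ^ 2 - 1 / 4) / x ^ 2 * (√x * besselI β x)) x := by
    intro x hx
    have hp := hasDerivAt_besselI hβ hx
    have hq := hasDerivAt_besselI_add_one hβ hx
    have hc : HasDerivAt (fun x : ℝ => (β + 1 / 2) / x) (-(β + 1 / 2) / x ^ 2) x := by
      refine ((hasDerivAt_inv hx.ne').const_mul (β + 1 / 2)).congr_deriv ?_
      ring
    refine ((Real.hasDerivAt_sqrt hx.ne').mul ((hp.add hq).add (hc.mul hp))).congr_deriv ?_
    have hs : √x ≠ 0 := (Real.sqrt_pos.mpr hx).ne'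
    have hs2 : 1 / (2 * √x) = √x / (2 * x) := by
      rw [div_eq_div_iff (by positivity) (by positivity)]
      linear_combination -2 * Real.mul_self_sqrt hx.le
    simp only [hE, hs2, Pi.add_apply, Pi.mul_apply]
    field_simp
    ring
  have hwd : ∀ x : ℝ, 0 < x → HasDerivAt w
      (Real.exp (β ^ 2 / x - x) * ((β ^ 2 - 1 / 4) / x ^ 2 * (√x * besselI β x) -
        β ^ 2 / x ^ 2 * E x)) x := by
    intro x hx
    have hc : HasDerivAt (fun x : ℝ => β ^ 2 / x - x) (-β ^ 2 / x ^ 2 - 1) x := by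
      refine (((hasDerivAt_inv hx.ne').const_mul (β ^ 2)).sub (hasDerivAt_id x)).congr_deriv ?_
      ring
    refine (hc.exp.mul (hEd x hx)).congr_deriv ?_
    ring
  have hpos : ∀ x : ℝ, 0 < x → 0 ≤ √x * besselI β x :=
    fun x hx => mul_nonneg (Real.sqrt_nonneg x) (besselI_nonneg hβ hx)
  have hle : ∀ x : ℝ, 0 < x → √x * besselI β x ≤ E x := by
    intro x hx
    have h0 := besselI_nonneg hβ hx
    have h1 := besselI_nonneg (β := β + 1) (by positivity) hx
    have h2 : 0 ≤ (β + 1 / 2) / x * besselI β x := by positivity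
    exact mul_le_mul_of_nonneg_left (by linarith) (Real.sqrt_nonneg x)
  have hanti : AntitoneOn w (Ici 1) := by
    have hIci : ∀ x ∈ Ici (1 : ℝ), 0 < x := fun x hx => lt_of_lt_of_le one_pos hx
    refine antitoneOn_of_deriv_nonpos (convex_Ici 1)
      (fun x hx => (hwd x (hIci x hx)).continuousAt.continuousWithinAt)
      (fun x hx => (hwd x (hIci x (interior_subset hx))).differentiableAt.differentiableWithinAt)
      fun x hx => ?_
    have hx0 := hIci x (interior_subset hx)
    rw [(hwd x hx0).deriv]
    refine mul_nonpos_of_nonneg_of_nonpos (Real.exp_pos _).le (sub_nonpos.mpr ?_)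
    have := hpos x hx0
    exact mul_le_mul (by gcongr; linarith) (hle x hx0) this (by positivity)
  have hw1 : 0 ≤ w 1 :=
    mul_nonneg (Real.exp_pos _).le ((hpos 1 one_pos).trans (hle 1 one_pos))
  refine ⟨w 1 + 1, by positivity, fun x hx => ?_⟩
  have hx0 : 0 < x := by linarith
  have hs : 0 < √x := Real.sqrt_pos.mpr hx0
  have hwx : w x ≤ w 1 := hanti self_mem_Ici hx hx
  have hE0 : 0 ≤ E x := (hpos x hx0).trans (hle x hx0)
  have hEx : E x ≤ w 1 * Real.exp x := by
    calc E x = Real.exp (-x) * E x * Real.exp x := by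
          rw [mul_right_comm, ← Real.exp_add]
          simp
      _ ≤ w x * Real.exp x := by
          simp only [hw]
          gcongr
          have : 0 ≤ β ^ 2 / x := by positivity
          linarith
      _ ≤ w 1 * Real.exp x := by gcongr
  rw [Real.rpow_neg hx0.le, ← Real.sqrt_eq_rpow, mul_right_comm, ← div_eq_mul_inv,
    le_div_iff₀ hs]
  nlinarith [hle x hx0, Real.exp_pos x]

lemma exists_besselI_shift_le {α : ℝ} (hα : 0 ≤ α) :
    ∃ C > 0, ∀ j : ℕ, j ≤ 2 → ∀ x : ℝ, 1 ≤ x →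
      besselI (α + j) x ≤ C * x ^ (-(1 / 2) : ℝ) * Real.exp x := by
  choose C hC h using fun j : ℕ => exists_besselI_le (β := α + j) (by positivity)
  refine ⟨∑ j ∈ Finset.range 3, C j, Finset.sum_pos (fun j _ => hC j) ⟨0, by simp⟩,
    fun j hj x hx => (h j x hx).trans ?_⟩
  gcongr
  exact Finset.single_le_sum (f := C) (fun i _ => (hC i).le) (Finset.mem_range.mpr (by omega))

lemma hasDerivAt_rpow_mul_besselI (a : ℝ) {β κ t : ℝ} (hβ : 0 ≤ β) (hκ : 0 < κ) (ht : 0 < t) :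
    HasDerivAt (fun t : ℝ => t ^ a * besselI β (κ * t))
      ((a + β) * (t ^ (a - 1) * besselI β (κ * t)) + κ * (t ^ a * besselI (β + 1) (κ * t))) t := by
  have hlin : HasDerivAt (fun t : ℝ => κ * t) κ t := by
    simpa using (hasDerivAt_id t).const_mul κ
  refine ((Real.hasDerivAt_rpow_const (p := a) (Or.inl ht.ne')).mul
    ((hasDerivAt_besselI hβ (mul_pos hκ ht)).comp t hlin)).congr_deriv ?_
  rw [Real.rpow_sub_one ht.ne']
  simp only [Function.comp_apply]
  field_simp
  ring

/-- derivative bounds for `ℐ_k(r) = r^{ν/2} I_{|1+ν/2|}(|k| r)`. -/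
theorem stmt11 (ν : ℝ) (hν : ν < 0) (hα : ¬ ∃ n : ℤ, |1 + ν / 2| = (n : ℝ)) :
    ∃ C > 0, ∀ k : ℤ, k ≠ 0 → ∀ r : ℝ, 1 ≤ r → ∀ n : ℕ, n ≤ 2 →
      |deriv^[n] (fun t : ℝ => t ^ (ν / 2) * besselI |1 + ν / 2| (|(k : ℝ)| * t)) r|
        ≤ C * |(k : ℝ)| ^ ((n : ℝ) - 1 / 2) * r ^ ((ν - 1) / 2)
            * Real.exp (|(k : ℝ)| * r) := by
  obtain ⟨C, hC, hI⟩ := exists_besselI_shift_le (abs_nonneg (1 + ν / 2))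
  have hα0 := abs_nonneg (1 + ν / 2)
  generalize |1 + ν / 2| = α at *
  refine ⟨C * ((|ν / 2 + α|) ^ 2 + 3 * |ν / 2 + α| + 2), by positivity, ?_⟩
  intro k hk r hr n hn
  have hκ : (1 : ℝ) ≤ |(k : ℝ)| := by exact_mod_cast Int.one_le_abs hk
  generalize |(k : ℝ)| = κ at *
  have hr0 : 0 < r := by linarith
  have hκ0 : 0 < κ := by linarith
  have hA := abs_nonneg (ν / 2 + α)
  set M : ℝ := κ ^ (-(1 / 2) : ℝ) * r ^ ((ν - 1) / 2) * Real.exp (κ * r) with hM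
  have hM0 : 0 ≤ C * M := by positivity
  have hrhs : C * ((|ν / 2 + α|) ^ 2 + 3 * |ν / 2 + α| + 2) * κ ^ ((n : ℝ) - 1 / 2) *
      r ^ ((ν - 1) / 2) * Real.exp (κ * r) =
      ((|ν / 2 + α|) ^ 2 + 3 * |ν / 2 + α| + 2) * κ ^ n * (C * M) := by
    rw [hM, sub_eq_add_neg, Real.rpow_add hκ0, Real.rpow_natCast]
    ring
  have hT : ∀ j : ℕ, j ≤ 2 → |r ^ (ν / 2) * besselI (α + j) (κ * r)| ≤ C * M := by
    intro j hj
    have h1 := hI j hj (κ * r) (by nlinarith)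
    have h0 : 0 ≤ besselI (α + j) (κ * r) := besselI_nonneg (by positivity) (by positivity)
    rw [abs_of_nonneg (by positivity)]
    calc r ^ (ν / 2) * besselI (α + j) (κ * r)
        ≤ r ^ (ν / 2) * (C * (κ * r) ^ (-(1 / 2) : ℝ) * Real.exp (κ * r)) := by gcongr
      _ = C * M := by
          rw [hM, Real.mul_rpow hκ0.le hr0.le,
            show (ν - 1) / 2 = ν / 2 + -(1 / 2) by ring, Real.rpow_add hr0]
          ring
  have hT0 := hT 0 (by norm_num)
  have hT1 := hT 1 (by norm_num)
  have hT2 := hT 2 le_rfl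
  simp only [Nat.cast_zero, add_zero, Nat.cast_one, Nat.cast_ofNat] at hT0 hT1 hT2
  rw [hrhs]
  have hderiv1 : ∀ t : ℝ, 0 < t →
      deriv (fun t : ℝ => t ^ (ν / 2) * besselI α (κ * t)) t =
      (ν / 2 + α) * (t ^ (ν / 2 - 1) * besselI α (κ * t)) +
        κ * (t ^ (ν / 2) * besselI (α + 1) (κ * t)) :=
    fun t ht => (hasDerivAt_rpow_mul_besselI (ν / 2) hα0 hκ0 ht).deriv
  have hinv : r⁻¹ ≤ 1 := inv_le_one_of_one_le₀ hr
  have hinv0 : 0 < r⁻¹ := by positivity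
  generalize hA' : |ν / 2 + α| = A at *
  interval_cases n
  · simp only [Function.iterate_zero, id_eq, pow_zero, mul_one]
    nlinarith [mul_nonneg hA hM0, mul_nonneg (mul_nonneg hA hA) hM0]
  · simp only [Function.iterate_one, pow_one]
    rw [hderiv1 r hr0, Real.rpow_sub_one hr0.ne']
    generalize besselI α (κ * r) = I0 at *
    generalize besselI (α + 1) (κ * r) = I1 at *
    calc |(ν / 2 + α) * (r ^ (ν / 2) / r * I0) + κ * (r ^ (ν / 2) * I1)|
        ≤ |(ν / 2 + α) * r⁻¹ * (r ^ (ν / 2) * I0)| + |κ * (r ^ (ν / 2) * I1)| := by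
          refine le_trans (le_of_eq ?_) (abs_add_le _ _)
          congr 1
          ring
      _ = A * r⁻¹ * |r ^ (ν / 2) * I0| + κ * |r ^ (ν / 2) * I1| := by
          simp only [abs_mul, hA', abs_of_pos hinv0, abs_of_pos hκ0]
      _ ≤ A * 1 * (C * M) + κ * (C * M) := by gcongr
      _ ≤ A * κ * (C * M) + κ * (C * M) := by gcongr
      _ = (A + 1) * κ * (C * M) := by ring
      _ ≤ (A ^ 2 + 3 * A + 2) * κ * (C * M) := by
          have : A + 1 ≤ A ^ 2 + 3 * A + 2 := by nlinarith
          gcongr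
  · have hev : deriv (fun t : ℝ => t ^ (ν / 2) * besselI α (κ * t)) =ᶠ[nhds r]
        fun t => (ν / 2 + α) * (t ^ (ν / 2 - 1) * besselI α (κ * t)) +
          κ * (t ^ (ν / 2) * besselI (α + 1) (κ * t)) := by
      filter_upwards [lt_mem_nhds hr0] with t ht using hderiv1 t ht
    have hd := ((hasDerivAt_rpow_mul_besselI (ν / 2 - 1) hα0 hκ0 hr0).const_mul
      (ν / 2 + α)).fun_add ((hasDerivAt_rpow_mul_besselI (ν / 2) (β := α + 1)
        (by positivity) hκ0 hr0).const_mul κ)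
    rw [show α + 1 + 1 = α + 2 by ring] at hd
    simp only [Function.iterate_succ, Function.iterate_zero, Function.comp_apply, id_eq]
    rw [hev.deriv_eq, hd.deriv, Real.rpow_sub_one hr0.ne', Real.rpow_sub_one hr0.ne']
    generalize besselI α (κ * r) = I0 at *
    generalize besselI (α + 1) (κ * r) = I1 at *
    generalize besselI (α + 2) (κ * r) = I2 at *
    have hAm : |ν / 2 + α - 1| ≤ A + 1 := by
      rw [← hA']
      simpa using abs_sub (ν / 2 + α) 1
    have hAp : |2 * (ν / 2 + α) + 1| ≤ 2 * A + 1 := by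
      rw [← hA']
      simpa [abs_mul] using abs_add_le (2 * (ν / 2 + α)) 1
    calc _ ≤ |(ν / 2 + α) * (ν / 2 + α - 1) * (r⁻¹ * r⁻¹) * (r ^ (ν / 2) * I0)| +
          |κ * (2 * (ν / 2 + α) + 1) * r⁻¹ * (r ^ (ν / 2) * I1)| +
          |κ ^ 2 * (r ^ (ν / 2) * I2)| := by
          refine le_trans (le_of_eq ?_) (abs_add_three _ _ _)
          congr 1
          ring
      _ = A * |ν / 2 + α - 1| * (r⁻¹ * r⁻¹) * |r ^ (ν / 2) * I0| +
          κ * |2 * (ν / 2 + α) + 1| * r⁻¹ * |r ^ (ν / 2) * I1| +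
          κ ^ 2 * |r ^ (ν / 2) * I2| := by
          rw [abs_mul, abs_mul, abs_mul, abs_mul (κ * _ * _), abs_mul (κ * _), abs_mul κ,
            abs_mul (κ ^ 2), abs_of_pos (mul_pos hinv0 hinv0), abs_of_pos hinv0,
            abs_of_pos hκ0, abs_of_pos (pow_pos hκ0 2), hA']
      _ ≤ A * (A + 1) * (1 * 1) * (C * M) + κ * (2 * A + 1) * 1 * (C * M) +
          κ ^ 2 * (C * M) := by gcongr
      _ = (A * (A + 1) * 1 + (2 * A + 1) * κ + κ ^ 2) * (C * M) := by ring
      _ ≤ (A * (A + 1) * κ ^ 2 + (2 * A + 1) * κ ^ 2 + κ ^ 2) * (C * M) := by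
          gcongr
          · exact one_le_pow₀ hκ
          · nlinarith
      _ = (A ^ 2 + 3 * A + 2) * κ ^ 2 * (C * M) := by ring
end
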